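/- For all x > 0 and y > 0: ∂³BS_Put/∂x²∂y (x,y) = (φ(d_+(x,y))/(2·x·y^{3/2})) · (d_−(x,y)·d_+(x,y) − 1). -/

import Mathlib

/-- Density of the standard normal distribution. -/
noncomputable def stdGaussianPDF (z : ℝ) : ℝ :=
  (Real.sqrt (2 * Real.pi))⁻¹ * Real.exp (-z ^ 2 / 2)

/-- Cumulative distribution function of the standard normal distribution. -/
noncomputable def stdGaussianCDF (z : ℝ) : ℝ :=
  ∫ t in Set.Iic z, stdGaussianPDF t

/-- d₊ from the Black–Scholes formula. -/
noncomputable def dPlus (K r T x y : ℝ) : ℝ :=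
  (Real.log (x / K) + r * T + y / 2) / Real.sqrt y

/-- d₋ from the Black–Scholes formula. -/
noncomputable def dMinus (K r T x y : ℝ) : ℝ :=
  (Real.log (x / K) + r * T - y / 2) / Real.sqrt y

/-- Black–Scholes put price with strike `K`, interest rate `r`, maturity `T`,
spot `x` and integrated variance `y`. -/
noncomputable def BSPut (K r T x y : ℝ) : ℝ :=
  K * Real.exp (-(r * T)) * stdGaussianCDF (-(dMinus K r T x y)) -
    x * stdGaussianCDF (-(dPlus K r T x y))

lemma continuous_stdGaussianPDF : Continuous stdGaussianPDF := by
  unfold stdGaussianPDF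
  fun_prop

lemma integrable_stdGaussianPDF : MeasureTheory.Integrable stdGaussianPDF := by
  have h := (integrable_exp_neg_mul_sq (b := 1 / 2) (by norm_num)).const_mul
    (Real.sqrt (2 * Real.pi))⁻¹
  refine h.congr (Filter.Eventually.of_forall fun z => ?_)
  simp only [stdGaussianPDF]
  ring_nf

lemma stdGaussianPDF_neg (z : ℝ) : stdGaussianPDF (-z) = stdGaussianPDF z := by
  simp [stdGaussianPDF]

lemma hasDerivAt_stdGaussianPDF (z : ℝ) :
    HasDerivAt stdGaussianPDF (-z * stdGaussianPDF z) z := by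
  have h : HasDerivAt (fun t : ℝ => -t ^ 2 / 2) (-z) z := by
    refine ((hasDerivAt_pow 2 z).neg.div_const 2).congr_deriv ?_
    norm_num
    ring
  refine (h.exp.const_mul (Real.sqrt (2 * Real.pi))⁻¹).congr_deriv ?_
  simp only [stdGaussianPDF]
  ring

lemma hasDerivAt_stdGaussianCDF (z : ℝ) :
    HasDerivAt stdGaussianCDF (stdGaussianPDF z) z := by
  have h : stdGaussianCDF = fun z => stdGaussianCDF 0 + ∫ t in (0 : ℝ)..z, stdGaussianPDF t := by
    funext z
    rw [← intervalIntegral.integral_Iic_sub_Iic integrable_stdGaussianPDF.integrableOn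
      integrable_stdGaussianPDF.integrableOn]
    simp only [stdGaussianCDF]
    ring
  rw [h]
  exact (intervalIntegral.integral_hasDerivAt_right
    (continuous_stdGaussianPDF.intervalIntegrable _ _)
    continuous_stdGaussianPDF.stronglyMeasurable.stronglyMeasurableAtFilter
    continuous_stdGaussianPDF.continuousAt).const_add _

lemma dMinus_eq_dPlus_sub_sqrt (K r T x y : ℝ) :
    dMinus K r T x y = dPlus K r T x y - Real.sqrt y := by
  rw [← Real.div_sqrt (x := y)]
  simp only [dMinus, dPlus]
  ring

/-- The discounted strike and the spot, weighted by the densities at `d₋` and `d₊`, agree. -/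
lemma strike_mul_stdGaussianPDF_dMinus {K x y : ℝ} (r T : ℝ) (hK : 0 < K) (hx : 0 < x)
    (hy : 0 < y) :
    K * Real.exp (-(r * T)) * stdGaussianPDF (dMinus K r T x y) =
      x * stdGaussianPDF (dPlus K r T x y) := by
  have hs : Real.sqrt y ≠ 0 := (Real.sqrt_pos.2 hy).ne'
  have hxK : x = K * Real.exp (Real.log (x / K)) := by
    rw [Real.exp_log (div_pos hx hK)]
    field_simp
  have hexp : -(r * T) + -dMinus K r T x y ^ 2 / 2 =
      Real.log (x / K) + -dPlus K r T x y ^ 2 / 2 := by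
    simp only [dMinus, dPlus, div_pow, Real.sq_sqrt hy.le]
    field_simp
    ring
  have hmul := congrArg Real.exp hexp
  rw [Real.exp_add, Real.exp_add] at hmul
  calc K * Real.exp (-(r * T)) * stdGaussianPDF (dMinus K r T x y)
      = (Real.sqrt (2 * Real.pi))⁻¹ * K *
          (Real.exp (-(r * T)) * Real.exp (-dMinus K r T x y ^ 2 / 2)) := by
        simp only [stdGaussianPDF]
        ring
    _ = K * Real.exp (Real.log (x / K)) * stdGaussianPDF (dPlus K r T x y) := by
        rw [hmul]
        simp only [stdGaussianPDF]
        ring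
    _ = x * stdGaussianPDF (dPlus K r T x y) := by rw [← hxK]

lemma hasDerivAt_BSPut_variance {K x y : ℝ} (r T : ℝ) (hK : 0 < K) (hx : 0 < x) (hy : 0 < y) :
    HasDerivAt (fun y' => BSPut K r T x y')
      (x * stdGaussianPDF (dPlus K r T x y) / (2 * Real.sqrt y)) y := by
  have hsqrt := Real.hasDerivAt_sqrt hy.ne'
  obtain ⟨D, hP⟩ : ∃ D, HasDerivAt (fun y' => dPlus K r T x y') D y :=
    ⟨_, (((hasDerivAt_id y).div_const 2).const_add (Real.log (x / K) + r * T)).div hsqrt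
      (Real.sqrt_pos.2 hy).ne'⟩
  have hM : HasDerivAt (fun y' => dMinus K r T x y') (D - 1 / (2 * Real.sqrt y)) y := by
    simp only [dMinus_eq_dPlus_sub_sqrt]
    exact hP.sub hsqrt
  have h := (((hasDerivAt_stdGaussianCDF _).comp y hM.neg).const_mul
    (K * Real.exp (-(r * T)))).sub
      (((hasDerivAt_stdGaussianCDF _).comp y hP.neg).const_mul x)
  refine h.congr_deriv ?_
  simp only [Pi.neg_apply, stdGaussianPDF_neg]
  linear_combination (-(D - 1 / (2 * Real.sqrt y))) *
    strike_mul_stdGaussianPDF_dMinus r T hK hx hy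

lemma hasDerivAt_dPlus_spot {K x : ℝ} (r T y : ℝ) (hK : 0 < K) (hx : 0 < x) :
    HasDerivAt (fun x' => dPlus K r T x' y) (1 / (x * Real.sqrt y)) x := by
  have hlog : HasDerivAt (fun x' => Real.log (x' / K)) (1 / x) x := by
    refine (((hasDerivAt_id x).div_const K).log (div_pos hx hK).ne').congr_deriv ?_
    simp only [id]
    field_simp
  refine (((hlog.add_const (r * T)).add_const (y / 2)).div_const (Real.sqrt y)).congr_deriv ?_
  rw [div_div]

lemma hasDerivAt_BSPut_spot_variance {K x y : ℝ} (r T : ℝ) (hK : 0 < K) (hx : 0 < x)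
    (hy : 0 < y) :
    HasDerivAt (fun x' => deriv (fun y' => BSPut K r T x' y') y)
      (-(stdGaussianPDF (dPlus K r T x y) * dMinus K r T x y) / (2 * y)) x := by
  have hs : Real.sqrt y ≠ 0 := (Real.sqrt_pos.2 hy).ne'
  have h := ((hasDerivAt_id x).mul ((hasDerivAt_stdGaussianPDF _).comp x
    (hasDerivAt_dPlus_spot r T y hK hx))).div_const (2 * Real.sqrt y)
  refine (h.congr_of_eventuallyEq ?_).congr_deriv ?_
  · filter_upwards [lt_mem_nhds hx] with x' hx'
    exact (hasDerivAt_BSPut_variance r T hK hx' hy).deriv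
  · rw [dMinus_eq_dPlus_sub_sqrt]
    simp only [id, Function.comp]
    field_simp
    rw [Real.sq_sqrt hy.le]
    ring

/-- Mixed third derivative (formula (5.3)):
`∂³BS_Put/∂x²∂y = (φ(d₊)/(2xy^{3/2}))·(d₋d₊ − 1)` for all `x, y > 0`. -/
theorem bsPut_third_partial_xxy (K r T : ℝ) (hK : 0 < K) (hT : 0 < T) :
    ∀ x y : ℝ, 0 < x → 0 < y →
      iteratedDeriv 2 (fun x' => deriv (fun y' => BSPut K r T x' y') y) x =
        stdGaussianPDF (dPlus K r T x y) / (2 * x * y ^ ((3 : ℝ) / 2)) *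
          (dMinus K r T x y * dPlus K r T x y - 1) := by
  intro x y hx hy
  have hs : Real.sqrt y ≠ 0 := (Real.sqrt_pos.2 hy).ne'
  have hpow : y ^ ((3 : ℝ) / 2) = y * Real.sqrt y := by
    rw [Real.sqrt_eq_rpow, show (3 : ℝ) / 2 = 1 + 1 / 2 by norm_num, Real.rpow_add hy,
      Real.rpow_one]
  have hP := hasDerivAt_dPlus_spot r T y hK hx
  have hM : HasDerivAt (fun x' => dMinus K r T x' y) (1 / (x * Real.sqrt y)) x := by
    simp only [dMinus_eq_dPlus_sub_sqrt]
    exact hP.sub_const _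
  have h := (((hasDerivAt_stdGaussianPDF _).comp x hP).mul hM).neg.div_const (2 * y)
  have hderiv : deriv (fun x' => deriv (fun y' => BSPut K r T x' y') y) =ᶠ[nhds x]
      fun x' => -(stdGaussianPDF (dPlus K r T x' y) * dMinus K r T x' y) / (2 * y) := by
    filter_upwards [lt_mem_nhds hx] with x' hx'
    exact (hasDerivAt_BSPut_spot_variance r T hK hx' hy).deriv
  rw [iteratedDeriv_succ, iteratedDeriv_one, hderiv.deriv_eq]
  refine (HasDerivAt.deriv h).trans ?_
  rw [hpow]
  simp only [Function.comp]
  field_simp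
  ring
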